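/- (Minimum eigenvalue bound for the integrated Kronecker Hessian.) Let Θ₀ be a p × p real symmetric positive definite matrix and Δ a p × p real symmetric matrix such that Θ₀ + Δ is positive definite (so that Θ₀ + vΔ is positive definite for all v ∈ [0,1]). Then the symmetric p² × p² matrix M = ∫₀¹ (1 − v) · (Θ₀ + vΔ)^{-1} ⊗ (Θ₀ + vΔ)^{-1} dv satisfies φ_min(M) ≥ (1/2) · min_{v ∈ [0,1]} φ_max(Θ₀ + vΔ)^{-2}, where φ_min and φ_max denote the smallest and largest eigenvalues of a symmetric matrix. -/

import Mathlib

open Matrix Kronecker intervalIntegral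

attribute [local instance] Matrix.normedAddCommGroup Matrix.normedSpace

/-- Smallest value of the Rayleigh quotient over the unit sphere; for a symmetric matrix this
is the smallest eigenvalue `φ_min`. -/
noncomputable def minEig {m : Type*} [Fintype m] (A : Matrix m m ℝ) : ℝ :=
  ⨅ x : {x : m → ℝ // ∑ i, x i ^ 2 = 1}, (x : m → ℝ) ⬝ᵥ (A *ᵥ (x : m → ℝ))

/-- Largest value of the Rayleigh quotient over the unit sphere; for a symmetric matrix this
is the largest eigenvalue `φ_max`. -/
noncomputable def maxEig {m : Type*} [Fintype m] (A : Matrix m m ℝ) : ℝ :=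
  ⨆ x : {x : m → ℝ // ∑ i, x i ^ 2 = 1}, (x : m → ℝ) ⬝ᵥ (A *ᵥ (x : m → ℝ))

theorem aux_bdd {m : Type*} [Fintype m] (A : Matrix m m ℝ) :
    BddAbove (Set.range fun x : {x : m → ℝ // ∑ i, x i ^ 2 = 1} =>
      (x : m → ℝ) ⬝ᵥ (A *ᵥ (x : m → ℝ))) := by
  refine ⟨∑ i, ∑ j, |A i j|, ?_⟩
  rintro _ ⟨⟨x, hx⟩, rfl⟩
  have h1 : ∀ i, |x i| ≤ 1 := by
    intro i
    rw [← sq_le_one_iff_abs_le_one, ← hx]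
    exact Finset.single_le_sum (f := fun i => x i ^ 2) (fun j _ => sq_nonneg _) (Finset.mem_univ i)
  simp only [dotProduct, mulVec, Finset.mul_sum]
  refine Finset.sum_le_sum fun i _ => Finset.sum_le_sum fun j _ => ?_
  refine (le_abs_self _).trans ?_
  rw [abs_mul, abs_mul]
  have := mul_le_mul (h1 i) (h1 j) (abs_nonneg _) zero_le_one
  nlinarith [abs_nonneg (A i j)]

theorem aux_le {m : Type*} [Fintype m] (A : Matrix m m ℝ) (y : m → ℝ) :
    y ⬝ᵥ (A *ᵥ y) ≤ maxEig A * (y ⬝ᵥ y) := by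
  by_cases hy : y = 0
  · simp [hy]
  have hs : 0 < y ⬝ᵥ y := by
    have := dotProduct_star_self_pos_iff.2 hy
    simpa using this
  set s := y ⬝ᵥ y with hsdef
  have hr : Real.sqrt s ^ 2 = s := Real.sq_sqrt hs.le
  have hr0 : Real.sqrt s ≠ 0 := (Real.sqrt_pos.2 hs).ne'
  have hu : ∑ i, (((Real.sqrt s)⁻¹ • y) i) ^ 2 = 1 := by
    simp only [Pi.smul_apply, smul_eq_mul, mul_pow, ← Finset.mul_sum]
    have : ∑ i, y i ^ 2 = s := by simp [hsdef, dotProduct, sq]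
    rw [this, inv_pow, hr, inv_mul_cancel₀ hs.ne']
  have := le_ciSup (aux_bdd A) ⟨_, hu⟩
  change _ ≤ maxEig A at this
  simp only [mulVec_smul, dotProduct_smul, smul_dotProduct, smul_eq_mul] at this
  rw [← mul_assoc, ← sq, inv_pow, hr, inv_mul_le_iff₀ hs] at this
  linarith

theorem aux_kron {p : ℕ} (hp : 0 < p) (A : Matrix (Fin p) (Fin p) ℝ) (hA : A.PosDef)
    (x : Fin p × Fin p → ℝ) (hx : ∑ i, x i ^ 2 = 1) :
    maxEig A ^ (-2 : ℤ) ≤ x ⬝ᵥ ((A⁻¹ ⊗ₖ A⁻¹) *ᵥ x) := by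
  set L := maxEig A with hL
  have hLpos : 0 < L := by
    have h := aux_le A (Pi.single ⟨0, hp⟩ 1)
    have h2 := hA.dotProduct_mulVec_pos (x := Pi.single ⟨0, hp⟩ 1) (by simp)
    simp at h h2
    linarith
  have hAs : Aᴴ = A := hA.isHermitian
  have hdet : IsUnit A.det := hA.det_pos.ne'.isUnit
  have hLA : (L • (1 : Matrix (Fin p) (Fin p) ℝ) - A).PosSemidef := by
    refine PosSemidef.of_dotProduct_mulVec_nonneg ?_ ?_
    · rw [IsHermitian, conjTranspose_sub, hAs]; simp
    · intro y
      have := aux_le A y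
      simp only [sub_mulVec, smul_mulVec, one_mulVec, dotProduct_sub, dotProduct_smul,
        smul_eq_mul, star_trivial]
      linarith
  have hAi : (A⁻¹).PosSemidef := hA.inv.posSemidef
  have hAis : (A⁻¹)ᴴ = A⁻¹ := hAi.isHermitian
  have hD : (A⁻¹ - L⁻¹ • (1 : Matrix (Fin p) (Fin p) ℝ)).PosSemidef := by
    have h1 := hA.posSemidef.conjTranspose_mul_mul_same
      (A⁻¹ - L⁻¹ • (1 : Matrix (Fin p) (Fin p) ℝ))
    have h2 := hLA.smul (sq_nonneg L⁻¹)
    have h3 := h1.add h2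
    convert h3 using 1
    simp only [conjTranspose_sub, conjTranspose_smul, conjTranspose_one, hAis, star_trivial,
      sub_mul, mul_sub, smul_mul_assoc, mul_smul_comm, one_mul, mul_one,
      nonsing_inv_mul _ hdet, mul_nonsing_inv _ hdet, smul_sub, smul_smul]
    have : L⁻¹ ^ 2 * L = L⁻¹ := by field_simp
    rw [this, sq]
    abel
  have hK : (A⁻¹ ⊗ₖ A⁻¹ - (L⁻¹ ^ 2) • (1 : Matrix (Fin p × Fin p) (Fin p × Fin p) ℝ)).PosSemidef := by
    have h1 := hD.kronecker hAi
    have h2 := ((PosSemidef.one (n := Fin p) (R := ℝ)).kronecker hD).smul (inv_nonneg.2 hLpos.le)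
    have h3 := h1.add h2
    refine cast (congrArg PosSemidef ?_) h3
    rw [← one_kronecker_one]
    ext ⟨i, j⟩ ⟨k, l⟩
    simp only [kroneckerMap_apply, Matrix.add_apply, Matrix.sub_apply, Matrix.smul_apply, smul_eq_mul]
    ring
  have h := hK.dotProduct_mulVec_nonneg x
  have hxx : x ⬝ᵥ x = 1 := by rw [← hx]; simp [dotProduct, sq]
  simp only [sub_mulVec, smul_mulVec, one_mulVec, dotProduct_sub, dotProduct_smul,
        smul_eq_mul, star_trivial, hxx] at h
  have : L ^ (-2 : ℤ) = L⁻¹ ^ 2 := by rw [_root_.zpow_neg, inv_pow]; rfl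
  linarith

theorem aux_pos {p : ℕ} (Θ₀ Δ : Matrix (Fin p) (Fin p) ℝ)
    (hΘ₀ : Θ₀.PosDef) (hΘΔ : (Θ₀ + Δ).PosDef) (v : ℝ) (h0 : 0 ≤ v) (h1 : v ≤ 1) :
    (Θ₀ + v • Δ).PosDef := by
  have e : Θ₀ + v • Δ = (1 - v) • Θ₀ + v • (Θ₀ + Δ) := by
    rw [sub_smul, one_smul, smul_add]; abel
  rcases h0.eq_or_lt with h | h
  · subst h; simpa using hΘ₀
  rw [e]
  exact PosDef.posSemidef_add (hΘ₀.posSemidef.smul (sub_nonneg.2 h1)) (hΘΔ.smul h)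

theorem aux_cont {p : ℕ} (Θ₀ Δ : Matrix (Fin p) (Fin p) ℝ)
    (hΘ₀ : Θ₀.PosDef) (hΘΔ : (Θ₀ + Δ).PosDef) :
    ContinuousOn (fun v : ℝ => ((1 : ℝ) - v) • ((Θ₀ + v • Δ)⁻¹ ⊗ₖ (Θ₀ + v • Δ)⁻¹))
      (Set.Icc 0 1) := by
  have hc : Continuous fun v : ℝ => Θ₀ + v • Δ :=
    continuous_const.add (continuous_id.smul continuous_const)
  have hi : ∀ i j, ContinuousOn (fun v : ℝ => (Θ₀ + v • Δ)⁻¹ i j) (Set.Icc 0 1) := by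
    intro i j
    simp only [inv_def, Ring.inverse_eq_inv, Matrix.smul_apply, smul_eq_mul]
    refine ContinuousOn.mul (ContinuousOn.inv₀ hc.matrix_det.continuousOn ?_) ?_
    · intro v hv
      exact (aux_pos Θ₀ Δ hΘ₀ hΘΔ v hv.1 hv.2).det_pos.ne'
    · exact (hc.matrix_adjugate.matrix_elem i j).continuousOn
  refine continuousOn_pi.2 fun i => continuousOn_pi.2 fun j => ?_
  exact ((continuous_const.sub continuous_id).continuousOn).mul ((hi _ _).mul (hi _ _))

theorem aux_int {E : Type*} [NormedAddCommGroup E] [NormedSpace ℝ E] [FiniteDimensional ℝ E]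
    (F : ℝ → E) (T : E →ₗ[ℝ] ℝ) (hF : ContinuousOn F (Set.Icc 0 1)) :
    T (∫ v in (0:ℝ)..1, F v) = ∫ v in (0:ℝ)..1, T (F v) ∧
      IntervalIntegrable (fun v => T (F v)) MeasureTheory.volume 0 1 := by
  have : CompleteSpace E := FiniteDimensional.complete ℝ E
  have hF' : ContinuousOn F (Set.uIcc 0 1) := by rwa [Set.uIcc_of_le zero_le_one]
  let T' : E →L[ℝ] ℝ := LinearMap.toContinuousLinearMap T
  exact ⟨(T'.intervalIntegral_comp_comm hF'.intervalIntegrable).symm,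
    (T'.continuous.comp_continuousOn hF').intervalIntegrable⟩

/-- **Minimum eigenvalue bound for the integrated Kronecker Hessian.**
If `Θ₀` is symmetric positive definite, `Δ` symmetric with `Θ₀ + Δ` positive definite, then
`M = ∫₀¹ (1 − v) (Θ₀ + vΔ)⁻¹ ⊗ (Θ₀ + vΔ)⁻¹ dv` satisfies
`φ_min(M) ≥ (1/2) min_{v ∈ [0,1]} φ_max(Θ₀ + vΔ)^{-2}`. -/
theorem integrated_kronecker_hessian_minEig (p : ℕ) (Θ₀ Δ : Matrix (Fin p) (Fin p) ℝ)
    (hΘ₀symm : Θ₀.IsSymm) (hΔsymm : Δ.IsSymm)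
    (hΘ₀ : Θ₀.PosDef) (hΘΔ : (Θ₀ + Δ).PosDef) :
    (1 / 2 : ℝ) * (⨅ v : Set.Icc (0:ℝ) 1, maxEig (Θ₀ + (v : ℝ) • Δ) ^ (-2 : ℤ))
      ≤ minEig (∫ v in (0:ℝ)..1,
          ((1 : ℝ) - v) • ((Θ₀ + v • Δ)⁻¹ ⊗ₖ (Θ₀ + v • Δ)⁻¹)) := by
  rcases Nat.eq_zero_or_pos p with hp | hp
  · subst hp
    simp [minEig, maxEig]
  have : Nonempty {x : Fin p × Fin p → ℝ // ∑ i, x i ^ 2 = 1} :=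
    ⟨⟨Pi.single (⟨0, hp⟩, ⟨0, hp⟩) 1, by simp [Pi.single_apply]⟩⟩
  refine le_ciInf ?_
  rintro ⟨x, hx⟩
  have hcont := aux_cont Θ₀ Δ hΘ₀ hΘΔ
  let T : Matrix (Fin p × Fin p) (Fin p × Fin p) ℝ →ₗ[ℝ] ℝ :=
    { toFun := fun B => x ⬝ᵥ (B *ᵥ x)
      map_add' := by intro a b; simp [add_mulVec, dotProduct_add]
      map_smul' := by intro a b; simp [smul_mulVec, dotProduct_smul] }
  obtain ⟨hcomm, hint⟩ := aux_int _ T hcont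
  change _ ≤ T _
  refine le_of_le_of_eq ?_ hcomm.symm
  set c := ⨅ v : Set.Icc (0:ℝ) 1, maxEig (Θ₀ + (v : ℝ) • Δ) ^ (-2 : ℤ) with hc
  have hcalc : ∫ v in (0:ℝ)..1, (1 - v) * c = 1 / 2 * c := by
    rw [intervalIntegral.integral_mul_const, intervalIntegral.integral_sub (by simp) (by simp)]
    simp
    norm_num
  rw [← hcalc]
  refine intervalIntegral.integral_mono_on zero_le_one ?_ ?_ ?_
  · exact Continuous.intervalIntegrable (by fun_prop) _ _
  · exact hint
  · intro v hv
    have hk := aux_kron hp _ (aux_pos Θ₀ Δ hΘ₀ hΘΔ v hv.1 hv.2) x hx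
    have hb : c ≤ maxEig (Θ₀ + v • Δ) ^ (-2 : ℤ) :=
      ciInf_le (f := fun v : Set.Icc (0:ℝ) 1 => maxEig (Θ₀ + (v : ℝ) • Δ) ^ (-2 : ℤ))
        ⟨0, by rintro _ ⟨w, rfl⟩; exact Even.zpow_nonneg (by decide) _⟩ ⟨v, hv⟩
    rw [map_smul, smul_eq_mul]
    exact mul_le_mul_of_nonneg_left (hb.trans hk) (sub_nonneg.2 hv.2)
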